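/- Let (Ω, μ) be a measure space and f, g : Ω → ℝ be measurable, nonnegative, integrable functions with ∫ f dμ = ∫ g dμ = 1, and let n1, n2 > 0 be real numbers. Then ∫ ((n1·f − n2·g)/(n1·f + n2·g))·(g − f) dμ ≤ 0, where all quotients use the convention that division by zero yields zero. -/

import Mathlib

open MeasureTheory

/-- Since `(a * s - b * t) / (a * s + b * t)` is monotone in `s / t`, replacing it by its value at
`s = t` can only increase its product with `t - s`. -/
theorem sub_div_add_mul_sub_le {a b s t : ℝ} (ha : 0 < a) (hb : 0 < b) (hs : 0 ≤ s) (ht : 0 ≤ t) :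
    (a * s - b * t) / (a * s + b * t) * (t - s) ≤ (a - b) / (a + b) * (t - s) := by
  have has := mul_nonneg ha.le hs
  have hbt := mul_nonneg hb.le ht
  rcases (add_nonneg has hbt).eq_or_lt with hD | hD
  · have hs0 : s = 0 := (mul_eq_zero.1 (by linarith : a * s = 0)).resolve_left ha.ne'
    have ht0 : t = 0 := (mul_eq_zero.1 (by linarith : b * t = 0)).resolve_left hb.ne'
    simp [hs0, ht0]
  · rw [← sub_nonneg]
    have h : (a - b) / (a + b) * (t - s) - (a * s - b * t) / (a * s + b * t) * (t - s)
        = 2 * a * b * (t - s) ^ 2 / ((a + b) * (a * s + b * t)) := by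
      field_simp
      ring
    rw [h]
    positivity

theorem stmt_3 {Ω : Type*} [MeasurableSpace Ω] (μ : Measure Ω)
    (f g : Ω → ℝ) (hf : Measurable f) (hg : Measurable g)
    (hf0 : ∀ x, 0 ≤ f x) (hg0 : ∀ x, 0 ≤ g x)
    (hfi : Integrable f μ) (hgi : Integrable g μ)
    (hf1 : ∫ x, f x ∂μ = 1) (hg1 : ∫ x, g x ∂μ = 1)
    (n1 n2 : ℝ) (hn1 : 0 < n1) (hn2 : 0 < n2) :
    ∫ x, ((n1 * f x - n2 * g x) / (n1 * f x + n2 * g x)) * (g x - f x) ∂μ ≤ 0 := by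
  have hint : Integrable
      (fun x => ((n1 * f x - n2 * g x) / (n1 * f x + n2 * g x)) * (g x - f x)) μ := by
    refine (hgi.sub hfi).bdd_mul (c := 1)
      (Measurable.aestronglyMeasurable (by fun_prop)) (.of_forall fun x => ?_)
    have hs := mul_nonneg hn1.le (hf0 x)
    have ht := mul_nonneg hn2.le (hg0 x)
    rw [Real.norm_eq_abs, abs_div, abs_of_nonneg (add_nonneg hs ht)]
    exact div_le_one_of_le₀ (abs_le.2 ⟨by linarith, by linarith⟩) (add_nonneg hs ht)
  calc ∫ x, ((n1 * f x - n2 * g x) / (n1 * f x + n2 * g x)) * (g x - f x) ∂μ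
      ≤ ∫ x, (n1 - n2) / (n1 + n2) * (g x - f x) ∂μ :=
        integral_mono hint ((hgi.sub hfi).const_mul _)
          fun x => sub_div_add_mul_sub_le hn1 hn2 (hf0 x) (hg0 x)
    _ = 0 := by rw [integral_const_mul, integral_sub hgi hfi, hf1, hg1, sub_self, mul_zero]
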